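/- arXiv:1601.03167 — 4 statements merged into one kernel-verified Lean document; each statement's English description precedes it below -/
import Mathlib

section
/- For every integer k ≥ 1 and every t ∈ (−k, −k+1), as z → t with Im z > 0 one has Im f₃(z) → −π·( R₃(t) + ((k−1)k(k+1)/6)·log|t| ) / ( t³·((log|t|)² + π²) ), i.e. Im f₃(z) → π·d̃₃(t). -/
open Complex Filter Topology Set

noncomputable section

/-- Euler–Mascheroni constant. -/
def γ : ℝ := Real.eulerMascheroniConstant

/-- The constant `D`. -/
def Dc : ℝ := -(1/6) * (γ + Real.pi^2/6 + 3/2)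

/-- The constant `E`. -/
def Ec : ℝ := (1/4) * (γ + Real.log (2*Real.pi) + 1/2)

/-- The constant `F`, with ζ'(-1) the (real) derivative value of the Riemann zeta function. -/
def Fc : ℝ := 3/8 - Real.log (2*Real.pi)/4 - (1/12 - (deriv riemannZeta (-1)).re)

/-- The series `log P₃(z)`. -/
def logP3 (z : ℂ) : ℂ :=
  ∑' n : ℕ, (let k : ℂ := (n : ℂ) + 1;
    -(k*(k+1)/2) * Complex.log (1 + z/k) + ((k+1)/2) * z
      - (1/4)*(1 + 1/k) * z^2 + (1/(6*k))*(1 + 1/k) * z^3)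

/-- The holomorphic branch `L₃(z)` of `log Γ₃(1+z)`. -/
def L3 (z : ℂ) : ℂ := (Dc : ℂ) * z^3 + (Ec : ℂ) * z^2 + (Fc : ℂ) * z + logP3 z

/-- The real version `R₃(t) = log |Γ₃(1+t)|`. -/
def R3 (t : ℝ) : ℝ :=
  Dc * t^3 + Ec * t^2 + Fc * t +
  ∑' n : ℕ, (let k : ℝ := (n : ℝ) + 1;
    -(k*(k+1)/2) * Real.log |1 + t/k| + ((k+1)/2) * t
      - (1/4)*(1 + 1/k) * t^2 + (1/(6*k))*(1 + 1/k) * t^3)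

/-- The function `f₃`. -/
def f3 (z : ℂ) : ℂ := L3 z / (z^3 * Complex.log z)

/-- The zero counting function `N₃`. -/
def N3 (s : ℝ) : ℝ := (⌊s⌋ : ℝ) * ((⌊s⌋ : ℝ) + 1) * ((⌊s⌋ : ℝ) + 2) / 6

open Classical in
/-- The density `d̃₃`. -/
def d3tilde (t : ℝ) : ℝ :=
  if t < 0 ∧ ¬ (∃ n : ℕ, t = -((n : ℝ) + 1)) then
    -(R3 t + N3 |t| * Real.log |t|) / (t^3 * ((Real.log |t|)^2 + Real.pi^2))
  else 0

end

noncomputable section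

/-- The `n`-th term of the series `logP3`. -/
def logP3Term (n : ℕ) (z : ℂ) : ℂ :=
  -(((n : ℂ) + 1) * ((n : ℂ) + 1 + 1) / 2) * Complex.log (1 + z / ((n : ℂ) + 1))
    + (((n : ℂ) + 1 + 1) / 2) * z
    - (1 / 4) * (1 + 1 / ((n : ℂ) + 1)) * z ^ 2
    + (1 / (6 * ((n : ℂ) + 1))) * (1 + 1 / ((n : ℂ) + 1)) * z ^ 3

lemma logP3_eq_tsum (z : ℂ) : logP3 z = ∑' n : ℕ, logP3Term n z := rfl

lemma logP3Term_eq_log_sub_logTaylor (n : ℕ) (z : ℂ) :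
    logP3Term n z = -(((n : ℂ) + 1) * ((n : ℂ) + 1 + 1) / 2) *
      (Complex.log (1 + z / ((n : ℂ) + 1)) - Complex.logTaylor 4 (z / ((n : ℂ) + 1))) := by
  have hn : (n : ℂ) + 1 ≠ 0 := Nat.cast_add_one_ne_zero n
  simp only [logP3Term, Complex.logTaylor, Finset.sum_range_succ, Finset.sum_range_zero]
  push_cast
  field_simp
  ring

lemma norm_logP3Term_le {M : ℝ} {n : ℕ} {z : ℂ} (hz : ‖z‖ ≤ M) (hn : 2 * M ≤ (n : ℝ) + 1) :
    ‖logP3Term n z‖ ≤ M ^ 4 * (1 / ((n : ℝ) + 1) ^ 2) := by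
  have hk : (0 : ℝ) < (n : ℝ) + 1 := by positivity
  have hk1 : (1 : ℝ) ≤ (n : ℝ) + 1 := by simp
  have hnorm : ‖(n : ℂ) + 1‖ = (n : ℝ) + 1 := by
    have := Complex.norm_natCast (n + 1)
    push_cast at this
    exact this
  have hnorm' : ‖(n : ℂ) + 1 + 1‖ = (n : ℝ) + 1 + 1 := by
    have := Complex.norm_natCast (n + 1 + 1)
    push_cast at this
    exact this
  set w : ℂ := z / ((n : ℂ) + 1) with hw
  have hwn : ‖w‖ = ‖z‖ / ((n : ℝ) + 1) := by rw [hw, norm_div, hnorm]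
  have hwM : ‖w‖ ≤ M / ((n : ℝ) + 1) := by rw [hwn]; gcongr
  have hw2 : ‖w‖ ≤ 1 / 2 := hwM.trans (by rw [div_le_iff₀ hk]; linarith)
  have htaylor : ‖Complex.log (1 + w) - Complex.logTaylor 4 w‖ ≤
      (M / ((n : ℝ) + 1)) ^ 4 / 2 := by
    have h := Complex.norm_log_sub_logTaylor_le 3 (lt_of_le_of_lt hw2 (by norm_num))
    have hM : 0 ≤ M := (norm_nonneg z).trans hz
    have hinv : (1 - ‖w‖)⁻¹ ≤ 2 := by
      rw [inv_le_comm₀ (by linarith) (by norm_num)]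
      linarith
    refine h.trans ?_
    calc ‖w‖ ^ (3 + 1) * (1 - ‖w‖)⁻¹ / ((3 : ℕ) + 1)
        ≤ (M / ((n : ℝ) + 1)) ^ (3 + 1) * 2 / ((3 : ℕ) + 1) := by
          gcongr
          exact inv_nonneg.mpr (by linarith)
      _ = (M / ((n : ℝ) + 1)) ^ 4 / 2 := by push_cast; ring
  rw [logP3Term_eq_log_sub_logTaylor, norm_mul, norm_neg, norm_div, norm_mul, hnorm, hnorm',
    Complex.norm_ofNat]
  calc ((n : ℝ) + 1) * ((n : ℝ) + 1 + 1) / 2 * ‖Complex.log (1 + w) - Complex.logTaylor 4 w‖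
      ≤ ((n : ℝ) + 1) * (((n : ℝ) + 1) + ((n : ℝ) + 1)) / 2 *
        ((M / ((n : ℝ) + 1)) ^ 4 / 2) := by gcongr
    _ = M ^ 4 * (1 / ((n : ℝ) + 1) ^ 2) / 2 := by field_simp; ring
    _ ≤ M ^ 4 * (1 / ((n : ℝ) + 1) ^ 2) := half_le_self (by positivity)

lemma summable_one_div_nat_add_one_sq : Summable fun n : ℕ => 1 / ((n : ℝ) + 1) ^ 2 := by
  have h := (summable_nat_add_iff 1).mpr (Real.summable_one_div_nat_pow.mpr one_lt_two)
  simpa using h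

lemma summable_logP3Term (z : ℂ) : Summable fun n : ℕ => logP3Term n z := by
  refine Summable.of_norm_bounded_eventually_nat
    (summable_one_div_nat_add_one_sq.mul_left (‖z‖ ^ 4)) ?_
  filter_upwards [eventually_ge_atTop ⌈2 * ‖z‖⌉₊] with n hn
  exact norm_logP3Term_le le_rfl ((Nat.ceil_le.mp hn).trans (by simp))

lemma continuousWithinAt_log_upper {x : ℝ} (hx : x ≠ 0) :
    ContinuousWithinAt Complex.log {z : ℂ | 0 ≤ z.im} (x : ℂ) := by
  rcases lt_or_gt_of_ne hx with h | h
  · exact Complex.continuousWithinAt_log_of_re_neg_of_im_zero (by simpa using h) (by simp)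
  · exact (continuousAt_clog (Complex.ofReal_mem_slitPlane.mpr h)).continuousWithinAt

lemma continuousWithinAt_logP3Term {t : ℝ} {n : ℕ} (ht : t ≠ -((n : ℝ) + 1)) :
    ContinuousWithinAt (logP3Term n) {z : ℂ | 0 ≤ z.im} (t : ℂ) := by
  have hk : (0 : ℝ) < (n : ℝ) + 1 := by positivity
  have hne : 1 + t / ((n : ℝ) + 1) ≠ 0 := by
    intro h
    field_simp at h
    exact ht (by linarith)
  have hcast : (1 : ℂ) + (t : ℂ) / ((n : ℂ) + 1) = ((1 + t / ((n : ℝ) + 1) : ℝ) : ℂ) := by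
    push_cast
    rfl
  have hlog : ContinuousWithinAt (fun z : ℂ => Complex.log (1 + z / ((n : ℂ) + 1)))
      {z : ℂ | 0 ≤ z.im} (t : ℂ) := by
    refine ContinuousWithinAt.comp (t := {z : ℂ | 0 ≤ z.im}) (g := Complex.log)
      (f := fun z : ℂ => 1 + z / ((n : ℂ) + 1)) ?_ (by fun_prop) ?_
    · rw [hcast]
      exact continuousWithinAt_log_upper hne
    · intro z hz
      have him : (1 + z / ((n : ℂ) + 1)).im = z.im / ((n : ℝ) + 1) := by
        have := Complex.div_ofReal_im z ((n : ℝ) + 1)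
        push_cast at this
        simp [this]
      simp only [mem_ofPred_eq] at hz ⊢
      rw [him]
      positivity
  unfold logP3Term
  exact (((continuousWithinAt_const.mul hlog).add (by fun_prop)).sub (by fun_prop)).add
    (by fun_prop)

lemma continuousWithinAt_logP3 {t : ℝ} (ht : ∀ n : ℕ, t ≠ -((n : ℝ) + 1)) :
    ContinuousWithinAt logP3 {z : ℂ | 0 ≤ z.im} (t : ℂ) := by
  set M : ℝ := ‖(t : ℂ)‖ + 1 with hM
  set N : ℕ := ⌈2 * M⌉₊
  set bound : ℕ → ℝ := fun n =>
    if n < N then ‖logP3Term n t‖ + 1 else M ^ 4 * (1 / ((n : ℝ) + 1) ^ 2) with hbound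
  have hsum : Summable bound := by
    refine (summable_one_div_nat_add_one_sq.mul_left (M ^ 4)).congr_atTop ?_
    filter_upwards [eventually_ge_atTop N] with n hn
    simp [hbound, not_lt.mpr hn]
  have hnear : ∀ᶠ z in 𝓝[{z : ℂ | 0 ≤ z.im}] (t : ℂ), ‖z‖ ≤ M :=
    nhdsWithin_le_nhds ((continuous_norm.tendsto (t : ℂ)).eventually_le_const (by simp [hM]))
  have hsmall : ∀ᶠ z in 𝓝[{z : ℂ | 0 ≤ z.im}] (t : ℂ), ∀ n ∈ Finset.range N,
      ‖logP3Term n z‖ ≤ ‖logP3Term n t‖ + 1 :=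
    (Filter.eventually_all_finset _).mpr fun n _ =>
      (continuousWithinAt_logP3Term (ht n)).norm.eventually_le_const (by simp)
  refine tendsto_tsum_of_dominated_convergence hsum
    (fun n => continuousWithinAt_logP3Term (ht n)) ?_
  filter_upwards [hnear, hsmall] with z hz hs n
  change ‖logP3Term n z‖ ≤ bound n
  by_cases hn : n < N
  · simpa [hbound, hn] using hs n (Finset.mem_range.mpr hn)
  · have hle : 2 * M ≤ (n : ℝ) := Nat.ceil_le.mp (not_lt.mp hn)
    rw [hbound]
    simp only [if_neg hn]
    exact norm_logP3Term_le hz (by linarith)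

lemma logP3Term_ofReal (n : ℕ) (t : ℝ) :
    logP3Term n t = -((((n : ℝ) + 1) * ((n : ℝ) + 1 + 1) / 2 : ℝ) : ℂ) *
        Complex.log ((1 + t / ((n : ℝ) + 1) : ℝ) : ℂ) +
      ((((n : ℝ) + 1 + 1) / 2 * t - 1 / 4 * (1 + 1 / ((n : ℝ) + 1)) * t ^ 2
        + 1 / (6 * ((n : ℝ) + 1)) * (1 + 1 / ((n : ℝ) + 1)) * t ^ 3 : ℝ) : ℂ) := by
  rw [logP3Term]
  push_cast
  ring

lemma logP3Term_ofReal_re (n : ℕ) (t : ℝ) :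
    (logP3Term n t).re =
      -(((n : ℝ) + 1) * ((n : ℝ) + 1 + 1) / 2) * Real.log |1 + t / ((n : ℝ) + 1)|
        + (((n : ℝ) + 1 + 1) / 2) * t
        - (1 / 4) * (1 + 1 / ((n : ℝ) + 1)) * t ^ 2
        + (1 / (6 * ((n : ℝ) + 1))) * (1 + 1 / ((n : ℝ) + 1)) * t ^ 3 := by
  rw [logP3Term_ofReal, ← Complex.ofReal_neg, Complex.add_re, Complex.re_ofReal_mul,
    Complex.ofReal_re, Complex.log_ofReal_re, Real.log_abs]
  ring

lemma logP3Term_ofReal_im (n : ℕ) (t : ℝ) :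
    (logP3Term n t).im = -(((n : ℝ) + 1) * ((n : ℝ) + 1 + 1) / 2) *
      Complex.arg ((1 + t / ((n : ℝ) + 1) : ℝ) : ℂ) := by
  rw [logP3Term_ofReal, ← Complex.ofReal_neg, Complex.add_im, Complex.im_ofReal_mul,
    Complex.ofReal_im, Complex.log_im, add_zero]

lemma logP3_ofReal_im {m : ℕ} {t : ℝ} (h₁ : -((m : ℝ) + 1) < t) (h₂ : t < -(m : ℝ)) :
    (logP3 t).im = -(Real.pi * ((m : ℝ) * (m + 1) * (m + 2) / 6)) := by
  have hterm_lt : ∀ n ∈ Finset.range m, (logP3Term n t).im =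
      -(((n : ℝ) + 1) * ((n : ℝ) + 1 + 1) / 2) * Real.pi := by
    intro n hn
    have hnm : (n : ℝ) + 1 ≤ m := by exact_mod_cast Finset.mem_range.mp hn
    have hk : (0 : ℝ) < (n : ℝ) + 1 := by positivity
    have hneg : 1 + t / ((n : ℝ) + 1) < 0 := by
      have : t / ((n : ℝ) + 1) < -1 := by rw [div_lt_iff₀ hk]; linarith
      linarith
    rw [logP3Term_ofReal_im, Complex.arg_ofReal_of_neg hneg]
  have hterm_ge : ∀ n ∉ Finset.range m, (logP3Term n t).im = 0 := by
    intro n hn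
    have hnm : (m : ℝ) ≤ n := by exact_mod_cast not_lt.mp (mt Finset.mem_range.mpr hn)
    have hk : (0 : ℝ) < (n : ℝ) + 1 := by positivity
    have hpos : 0 ≤ 1 + t / ((n : ℝ) + 1) := by
      have : -1 ≤ t / ((n : ℝ) + 1) := by rw [le_div_iff₀ hk]; linarith
      linarith
    rw [logP3Term_ofReal_im, Complex.arg_ofReal_of_nonneg hpos, mul_zero]
  have hsum : ∀ m : ℕ, ∑ n ∈ Finset.range m, -(((n : ℝ) + 1) * ((n : ℝ) + 1 + 1) / 2) * Real.pi =
      -(Real.pi * ((m : ℝ) * (m + 1) * (m + 2) / 6)) := by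
    intro m
    induction m with
    | zero => simp
    | succ m ih =>
      rw [Finset.sum_range_succ, ih]
      push_cast
      ring
  rw [logP3_eq_tsum, Complex.im_tsum (summable_logP3Term t), tsum_eq_sum hterm_ge,
    Finset.sum_congr rfl hterm_lt, hsum]

lemma L3_ofReal {m : ℕ} {t : ℝ} (h₁ : -((m : ℝ) + 1) < t) (h₂ : t < -(m : ℝ)) :
    L3 t = ⟨R3 t, -(Real.pi * ((m : ℝ) * (m + 1) * (m + 2) / 6))⟩ := by
  have hpoly : (Dc : ℂ) * (t : ℂ) ^ 3 + (Ec : ℂ) * (t : ℂ) ^ 2 + (Fc : ℂ) * (t : ℂ) =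
      ((Dc * t ^ 3 + Ec * t ^ 2 + Fc * t : ℝ) : ℂ) := by
    push_cast
    rfl
  apply Complex.ext
  · rw [L3, hpoly, Complex.add_re, Complex.ofReal_re, logP3_eq_tsum,
      Complex.re_tsum (summable_logP3Term t)]
    simp only [logP3Term_ofReal_re]
    rfl
  · rw [L3, hpoly, Complex.add_im, Complex.ofReal_im, logP3_ofReal_im h₁ h₂, zero_add]

lemma ne_neg_nat_add_one {m : ℕ} {t : ℝ} (h₁ : -((m : ℝ) + 1) < t) (h₂ : t < -(m : ℝ)) (n : ℕ) :
    t ≠ -((n : ℝ) + 1) := by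
  rintro rfl
  have hlt : (n : ℝ) + 1 < m + 1 := by linarith
  have hgt : (m : ℝ) < n + 1 := by linarith
  norm_cast at hlt hgt
  omega

lemma f3_ofReal_im {m : ℕ} {t : ℝ} (h₁ : -((m : ℝ) + 1) < t) (h₂ : t < -(m : ℝ)) :
    (f3 t).im = -(Real.pi * (R3 t + ((m : ℝ) * (m + 1) * (m + 2) / 6) * Real.log |t|)
      / (t ^ 3 * ((Real.log |t|) ^ 2 + Real.pi ^ 2))) := by
  have ht : t < 0 := h₂.trans_le (by simp)
  have hlog : Complex.log (t : ℂ) = ⟨Real.log |t|, Real.pi⟩ := by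
    apply Complex.ext
    · rw [Complex.log_ofReal_re, Real.log_abs]
    · rw [Complex.log_im, Complex.arg_ofReal_of_neg ht]
  have hq : (Real.log |t|) ^ 2 + Real.pi ^ 2 ≠ 0 := by positivity
  rw [f3, L3_ofReal h₁ h₂, hlog, ← Complex.ofReal_pow, mul_comm ((t ^ 3 : ℝ) : ℂ), ← div_div,
    Complex.div_ofReal_im, Complex.div_im]
  simp only [Complex.normSq_mk, ← sq]
  field_simp
  ring

lemma continuousWithinAt_f3 {t : ℝ} (ht : t < 0) (ht' : ∀ n : ℕ, t ≠ -((n : ℝ) + 1)) :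
    ContinuousWithinAt f3 {z : ℂ | 0 ≤ z.im} (t : ℂ) := by
  have hL : ContinuousWithinAt L3 {z : ℂ | 0 ≤ z.im} (t : ℂ) := by
    unfold L3
    exact ContinuousWithinAt.add (by fun_prop) (continuousWithinAt_logP3 ht')
  have hlog : Complex.log (t : ℂ) ≠ 0 := by
    intro h
    have := congrArg Complex.im h
    rw [Complex.log_im, Complex.arg_ofReal_of_neg ht] at this
    exact Real.pi_ne_zero this
  exact hL.div (ContinuousWithinAt.mul (by fun_prop) (continuousWithinAt_log_upper ht.ne))
    (mul_ne_zero (pow_ne_zero _ (by exact_mod_cast ht.ne)) hlog)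

lemma N3_abs_eq {m : ℕ} {t : ℝ} (h₁ : -((m : ℝ) + 1) < t) (h₂ : t < -(m : ℝ)) :
    N3 |t| = (m : ℝ) * (m + 1) * (m + 2) / 6 := by
  have ht : t < 0 := h₂.trans_le (by simp)
  have hfloor : ⌊|t|⌋ = (m : ℤ) := by
    rw [Int.floor_eq_iff, abs_of_neg ht]
    push_cast
    constructor <;> linarith
  rw [N3, hfloor]
  push_cast
  ring

end

/-- Boundary values of `Im f₃` on `(−k, −k+1)`. -/
theorem im_f3_boundary_limit :
    ∀ k : ℕ, 1 ≤ k → ∀ t : ℝ, t ∈ Set.Ioo (-(k:ℝ)) (-(k:ℝ)+1) →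
      Tendsto (fun z : ℂ => (f3 z).im) (𝓝[{z : ℂ | 0 < z.im}] (t : ℂ))
        (𝓝 (-(Real.pi * (R3 t + (((k:ℝ)-1)*(k:ℝ)*((k:ℝ)+1)/6) * Real.log |t|)
              / (t^3 * ((Real.log |t|)^2 + Real.pi^2))))) ∧
      -(Real.pi * (R3 t + (((k:ℝ)-1)*(k:ℝ)*((k:ℝ)+1)/6) * Real.log |t|)
          / (t^3 * ((Real.log |t|)^2 + Real.pi^2))) = Real.pi * d3tilde t := by
  intro k hk t ht
  obtain ⟨m, rfl⟩ := Nat.exists_eq_add_of_le' hk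
  have h₁ : -((m : ℝ) + 1) < t := by simpa using ht.1
  have h₂ : t < -(m : ℝ) := by
    have := ht.2
    push_cast at this
    linarith
  have hneg : t < 0 := h₂.trans_le (by simp)
  have hne := ne_neg_nat_add_one h₁ h₂
  have hN : (((m + 1 : ℕ) : ℝ) - 1) * ((m + 1 : ℕ) : ℝ) * (((m + 1 : ℕ) : ℝ) + 1) / 6 =
      (m : ℝ) * (m + 1) * (m + 2) / 6 := by
    push_cast
    ring
  rw [hN]
  constructor
  · rw [← f3_ofReal_im h₁ h₂]
    have hcont := (continuousWithinAt_f3 hneg hne).mono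
      (fun z (hz : 0 < z.im) => (hz.le : 0 ≤ z.im))
    exact (Complex.continuous_im.tendsto _).comp hcont
  · rw [d3tilde, if_pos ⟨hneg, fun ⟨n, hn⟩ => hne n hn⟩, N3_abs_eq h₁ h₂]
    ring
end

section
/- As the real variable x tends to +∞, R₃(x)/(x³·log x) → 1/6; that is, lim_{x→∞} log Γ₃(x+1)/(x³ log x) = 1/6 for the Barnes triple Gamma function Γ₃. -/
open Complex Filter Topology Set

/-- A real function vanishing at `0` with nonnegative derivative on `[0, ∞)` is nonnegative there. -/
theorem nonneg_of_hasDerivAt_nonneg {f f' : ℝ → ℝ} (h0 : f 0 = 0)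
    (hd : ∀ u, 0 ≤ u → HasDerivAt f (f' u) u) (hf' : ∀ u, 0 ≤ u → 0 ≤ f' u)
    {u : ℝ} (hu : 0 ≤ u) : 0 ≤ f u := by
  have hmono : MonotoneOn f (Ici 0) := by
    refine monotoneOn_of_deriv_nonneg (convex_Ici 0)
      (fun v hv => (hd v hv).continuousAt.continuousWithinAt) ?_ ?_
    · intro v hv
      rw [interior_Ici] at hv
      exact (hd v (le_of_lt hv)).differentiableAt.differentiableWithinAt
    · intro v hv
      rw [interior_Ici] at hv
      rw [(hd v (le_of_lt hv)).deriv]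
      exact hf' v (le_of_lt hv)
  have h := hmono (mem_Ici.2 le_rfl) (mem_Ici.2 hu) hu
  rwa [h0] at h

theorem hasDerivAt_log_one_add {u : ℝ} (hu : 0 ≤ u) :
    HasDerivAt (fun v : ℝ => Real.log (1 + v)) (1 / (1 + u)) u :=
  ((hasDerivAt_id u).const_add 1).log (by simp only [id]; positivity)

theorem sub_sq_div_two_le_log_one_add {u : ℝ} (hu : 0 ≤ u) :
    u - u ^ 2 / 2 ≤ Real.log (1 + u) := by
  have h := nonneg_of_hasDerivAt_nonneg
    (f := fun v => Real.log (1 + v) - (v - v ^ 2 / 2)) (f' := fun v => v ^ 2 / (1 + v))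
    (by simp) (fun v hv => by
      refine HasDerivAt.congr_deriv ((hasDerivAt_log_one_add hv).sub
        ((hasDerivAt_id v).sub ((hasDerivAt_pow 2 v).div_const 2))) ?_
      have : 1 + v ≠ 0 := by positivity
      push_cast
      field_simp
      ring) (fun v hv => by positivity) hu
  linarith

theorem log_one_add_le_cubic {u : ℝ} (hu : 0 ≤ u) :
    Real.log (1 + u) ≤ u - u ^ 2 / 2 + u ^ 3 / 3 := by
  have h := nonneg_of_hasDerivAt_nonneg
    (f := fun v => (v - v ^ 2 / 2 + v ^ 3 / 3) - Real.log (1 + v)) (f' := fun v => v ^ 3 / (1 + v))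
    (by simp) (fun v hv => by
      refine HasDerivAt.congr_deriv ((((hasDerivAt_id v).sub ((hasDerivAt_pow 2 v).div_const 2)).add
        ((hasDerivAt_pow 3 v).div_const 3)).sub (hasDerivAt_log_one_add hv)) ?_
      have : 1 + v ≠ 0 := by positivity
      push_cast
      field_simp
      ring) (fun v hv => by positivity) hu
  linarith

theorem quartic_le_log_one_add {u : ℝ} (hu : 0 ≤ u) :
    u - u ^ 2 / 2 + u ^ 3 / 3 - u ^ 4 / 4 ≤ Real.log (1 + u) := by
  have h := nonneg_of_hasDerivAt_nonneg
    (f := fun v => Real.log (1 + v) - (v - v ^ 2 / 2 + v ^ 3 / 3 - v ^ 4 / 4))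
    (f' := fun v => v ^ 4 / (1 + v))
    (by simp) (fun v hv => by
      refine HasDerivAt.congr_deriv ((hasDerivAt_log_one_add hv).sub
        ((((hasDerivAt_id v).sub ((hasDerivAt_pow 2 v).div_const 2)).add
        ((hasDerivAt_pow 3 v).div_const 3)).sub ((hasDerivAt_pow 4 v).div_const 4))) ?_
      have : 1 + v ≠ 0 := by positivity
      push_cast
      field_simp
      ring) (fun v hv => by positivity) hu
  linarith

/-- The summand of the series in `R3`, with `k = n + 1`. -/
noncomputable def R3Term (t : ℝ) (n : ℕ) : ℝ :=
  let k : ℝ := (n : ℝ) + 1;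
  -(k*(k+1)/2) * Real.log |1 + t/k| + ((k+1)/2) * t
    - (1/4)*(1 + 1/k) * t^2 + (1/(6*k))*(1 + 1/k) * t^3

theorem R3Term_eq {t : ℝ} (ht : 0 ≤ t) (n : ℕ) :
    R3Term t n = ((n : ℝ) + 1) * ((n : ℝ) + 1 + 1) / 2 *
      (t / ((n : ℝ) + 1) - (t / ((n : ℝ) + 1)) ^ 2 / 2 + (t / ((n : ℝ) + 1)) ^ 3 / 3
        - Real.log (1 + t / ((n : ℝ) + 1))) := by
  have hk : (n : ℝ) + 1 ≠ 0 := by positivity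
  have habs : |1 + t / ((n : ℝ) + 1)| = 1 + t / ((n : ℝ) + 1) := abs_of_nonneg (by positivity)
  simp only [R3Term, habs]
  field_simp
  ring

theorem R3Term_nonneg {t : ℝ} (ht : 0 ≤ t) (n : ℕ) : 0 ≤ R3Term t n := by
  rw [R3Term_eq ht]
  have hu : 0 ≤ t / ((n : ℝ) + 1) := by positivity
  exact mul_nonneg (by positivity) (sub_nonneg.2 (log_one_add_le_cubic hu))

theorem R3Term_le_quartic {t : ℝ} (ht : 0 ≤ t) (n : ℕ) :
    R3Term t n ≤ t ^ 4 / 4 * (1 / ((n : ℝ) + 1) ^ 2) := by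
  rw [R3Term_eq ht]
  have hk : 0 < (n : ℝ) + 1 := by positivity
  have hu : 0 ≤ t / ((n : ℝ) + 1) := by positivity
  have hn : (0 : ℝ) ≤ n := n.cast_nonneg
  calc _ ≤ ((n : ℝ) + 1) * ((n : ℝ) + 1 + 1) / 2 * ((t / ((n : ℝ) + 1)) ^ 4 / 4) := by
        gcongr
        linarith [quartic_le_log_one_add hu]
    _ ≤ (((n : ℝ) + 1) * (2 * ((n : ℝ) + 1)) / 2) * ((t / ((n : ℝ) + 1)) ^ 4 / 4) := by
        gcongr
        linarith
    _ = _ := by field_simp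

theorem R3Term_le_cubic {t : ℝ} (ht : 0 ≤ t) (n : ℕ) :
    R3Term t n ≤ t ^ 3 / 6 * (((n : ℝ) + 1)⁻¹ + 1 / ((n : ℝ) + 1) ^ 2) := by
  rw [R3Term_eq ht]
  have hk : 0 < (n : ℝ) + 1 := by positivity
  have hu : 0 ≤ t / ((n : ℝ) + 1) := by positivity
  calc _ ≤ ((n : ℝ) + 1) * ((n : ℝ) + 1 + 1) / 2 * ((t / ((n : ℝ) + 1)) ^ 3 / 3) := by
        gcongr
        linarith [sub_sq_div_two_le_log_one_add hu]
    _ = _ := by field_simp; ring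

theorem cubic_sub_sq_le_R3Term {t : ℝ} (ht : 0 ≤ t) (n : ℕ) :
    t ^ 3 / 6 * ((n : ℝ) + 1)⁻¹ - t ^ 2 / 2 ≤ R3Term t n := by
  rw [R3Term_eq ht]
  have hk : 0 < (n : ℝ) + 1 := by positivity
  have hn : (0 : ℝ) ≤ n := n.cast_nonneg
  have hu : 0 ≤ t / ((n : ℝ) + 1) := by positivity
  have hlog : Real.log (1 + t / ((n : ℝ) + 1)) ≤ t / ((n : ℝ) + 1) := by
    linarith [Real.log_le_sub_one_of_pos (show 0 < 1 + t / ((n : ℝ) + 1) by positivity)]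
  have hsq : t ^ 2 / 4 * (1 + ((n : ℝ) + 1)⁻¹) ≤ t ^ 2 / 4 * (1 + 1) := by
    gcongr
    exact inv_le_one_of_one_le₀ (by linarith)
  have hcube : 0 ≤ t ^ 3 / 6 * (1 / ((n : ℝ) + 1) ^ 2) := by positivity
  calc _ ≤ t ^ 3 / 6 * (((n : ℝ) + 1)⁻¹ + 1 / ((n : ℝ) + 1) ^ 2)
          - t ^ 2 / 4 * (1 + ((n : ℝ) + 1)⁻¹) := by linarith
    _ = ((n : ℝ) + 1) * ((n : ℝ) + 1 + 1) / 2 *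
          ((t / ((n : ℝ) + 1)) ^ 3 / 3 - (t / ((n : ℝ) + 1)) ^ 2 / 2) := by field_simp; ring
    _ ≤ _ := mul_le_mul_of_nonneg_left (by linarith) (by positivity)

theorem sum_range_one_div_sq_le (a m : ℕ) :
    ∑ n ∈ Finset.range m, 1 / (((n + a : ℕ) : ℝ) + 1) ^ 2 ≤ 2 / ((a : ℝ) + 1) := by
  suffices h : ∑ n ∈ Finset.range m, 1 / (((n + a : ℕ) : ℝ) + 1) ^ 2
      ≤ 2 / ((a : ℝ) + 1) - 2 / ((m : ℝ) + a + 1) by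
    have : 0 ≤ 2 / ((m : ℝ) + a + 1) := by positivity
    linarith
  induction m with
  | zero => simp
  | succ m ih =>
    rw [Finset.sum_range_succ]
    have hstep : 1 / (((m + a : ℕ) : ℝ) + 1) ^ 2
        ≤ 2 / ((m : ℝ) + a + 1) - 2 / (((m + 1 : ℕ) : ℝ) + a + 1) := by
      push_cast
      have h1 : (0 : ℝ) < (m : ℝ) + a + 1 := by positivity
      have h2 : (0 : ℝ) < (m : ℝ) + 1 + a + 1 := by positivity
      rw [div_sub_div _ _ h1.ne' h2.ne', div_le_div_iff₀ (by positivity) (by positivity)]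
      have hm : (0 : ℝ) ≤ (m : ℝ) + a := by positivity
      nlinarith [mul_nonneg hm h1.le]
    linarith

theorem summable_R3Term {t : ℝ} (ht : 0 ≤ t) : Summable (R3Term t) := by
  refine Summable.of_nonneg_of_le (R3Term_nonneg ht) (R3Term_le_quartic ht) (Summable.mul_left _ ?_)
  exact summable_of_sum_range_le (c := 2 / (((0 : ℕ) : ℝ) + 1)) (fun n => by positivity)
    (fun m => by simpa using sum_range_one_div_sq_le 0 m)

theorem tsum_R3Term_tail_le {t : ℝ} (ht : 0 ≤ t) (N : ℕ) :
    ∑' n, R3Term t (n + N) ≤ t ^ 4 / 2 / ((N : ℝ) + 1) := by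
  refine Real.tsum_le_of_sum_range_le (fun n => R3Term_nonneg ht _) fun m => ?_
  calc _ ≤ ∑ n ∈ Finset.range m, t ^ 4 / 4 * (1 / (((n + N : ℕ) : ℝ) + 1) ^ 2) :=
        Finset.sum_le_sum fun n _ => R3Term_le_quartic ht _
    _ = t ^ 4 / 4 * ∑ n ∈ Finset.range m, 1 / (((n + N : ℕ) : ℝ) + 1) ^ 2 := by
        rw [Finset.mul_sum]
    _ ≤ t ^ 4 / 4 * (2 / ((N : ℝ) + 1)) := by
        gcongr
        exact sum_range_one_div_sq_le N m
    _ = _ := by ring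

theorem cast_harmonic_eq_sum (N : ℕ) :
    ((harmonic N : ℚ) : ℝ) = ∑ n ∈ Finset.range N, ((n : ℝ) + 1)⁻¹ := by
  simp [harmonic]

/-- The series in `R3` is `x ^ 3 * log x / 6` up to an error of order `x ^ 3`. -/
theorem abs_tsum_R3Term_sub_le {x : ℝ} (hx : 1 ≤ x) :
    |∑' n, R3Term x n - x ^ 3 * Real.log x / 6| ≤ x ^ 3 := by
  have hx0 : 0 ≤ x := by linarith
  have hx3 : 0 ≤ x ^ 3 := by positivity
  obtain ⟨N, hN⟩ : ∃ N, N = ⌊x⌋₊ := ⟨_, rfl⟩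
  have hNx : (N : ℝ) ≤ x := hN ▸ Nat.floor_le hx0
  have hxN : x ≤ (N : ℝ) + 1 := hN ▸ (Nat.lt_floor_add_one x).le
  have hN1 : 1 ≤ N := hN ▸ Nat.le_floor (by simpa using hx)
  have hN1' : (0 : ℝ) < N := by exact_mod_cast hN1
  have hlow : Real.log x ≤ ∑ n ∈ Finset.range N, ((n : ℝ) + 1)⁻¹ := by
    rw [← cast_harmonic_eq_sum]
    refine (Real.log_le_log (by linarith) hxN).trans ?_
    exact_mod_cast log_add_one_le_harmonic N
  have hhigh : ∑ n ∈ Finset.range N, ((n : ℝ) + 1)⁻¹ ≤ 1 + Real.log x := by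
    rw [← cast_harmonic_eq_sum]
    linarith [harmonic_le_one_add_log N, Real.log_le_log hN1' hNx]
  have hsq : ∑ n ∈ Finset.range N, 1 / ((n : ℝ) + 1) ^ 2 ≤ 2 := by
    simpa using sum_range_one_div_sq_le 0 N
  have htail0 : 0 ≤ ∑' n, R3Term x (n + N) := tsum_nonneg fun n => R3Term_nonneg hx0 _
  have htail : ∑' n, R3Term x (n + N) ≤ x ^ 3 / 2 := by
    refine (tsum_R3Term_tail_le hx0 N).trans ?_
    rw [div_le_iff₀ (by positivity)]
    nlinarith [mul_le_mul_of_nonneg_left hxN hx3]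
  have hhead_le : ∑ n ∈ Finset.range N, R3Term x n ≤ x ^ 3 / 6 * (1 + Real.log x + 2) := by
    refine (Finset.sum_le_sum fun n _ => R3Term_le_cubic hx0 n).trans ?_
    rw [← Finset.mul_sum, Finset.sum_add_distrib]
    gcongr
  have hhead_ge : x ^ 3 / 6 * Real.log x - x ^ 3 / 2 ≤ ∑ n ∈ Finset.range N, R3Term x n := by
    refine le_trans ?_ (Finset.sum_le_sum fun n _ => cubic_sub_sq_le_R3Term hx0 n)
    rw [Finset.sum_sub_distrib, ← Finset.mul_sum, Finset.sum_const, Finset.card_range, nsmul_eq_mul]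
    have h1 : x ^ 3 / 6 * Real.log x ≤ x ^ 3 / 6 * ∑ n ∈ Finset.range N, ((n : ℝ) + 1)⁻¹ := by
      gcongr
    have h2 : (N : ℝ) * (x ^ 2 / 2) ≤ x * (x ^ 2 / 2) := by gcongr
    linarith
  rw [← (summable_R3Term hx0).sum_add_tsum_nat_add N, abs_le]
  constructor <;> linarith

theorem R3_eq (x : ℝ) :
    R3 x = Dc * x ^ 3 + Ec * x ^ 2 + Fc * x + ∑' n, R3Term x n := rfl

/-- `log Γ₃(x+1)/(x³ log x) → 1/6` as `x → ∞`. -/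
theorem R3_div_tendsto_one_sixth :
    Tendsto (fun x : ℝ => R3 x / (x^3 * Real.log x)) atTop (𝓝 (1/6)) := by
  have hzero : Tendsto (fun x : ℝ => (|Dc| + |Ec| + |Fc| + 1) / Real.log x) atTop (𝓝 0) :=
    Real.tendsto_log_atTop.const_div_atTop _
  rw [tendsto_iff_norm_sub_tendsto_zero]
  refine squeeze_zero' (Eventually.of_forall fun x => norm_nonneg _) ?_ hzero
  filter_upwards [eventually_gt_atTop 1] with x hx
  have hlog : 0 < Real.log x := Real.log_pos hx
  have hx3 : 0 < x ^ 3 := by positivity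
  have hmain := abs_tsum_R3Term_sub_le hx.le
  have hD : |Dc * x ^ 3| = |Dc| * x ^ 3 := by rw [abs_mul, abs_of_pos hx3]
  have hE : |Ec * x ^ 2| ≤ |Ec| * x ^ 3 := by
    rw [abs_mul, abs_of_nonneg (by positivity : 0 ≤ x ^ 2)]
    gcongr
    · exact hx.le
    · norm_num
  have hF : |Fc * x| ≤ |Fc| * x ^ 3 := by
    rw [abs_mul, abs_of_nonneg (by positivity : 0 ≤ x)]
    gcongr
    exact le_self_pow₀ hx.le (by norm_num)
  have heq : R3 x / (x ^ 3 * Real.log x) - 1 / 6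
      = (Dc * x ^ 3 + Ec * x ^ 2 + Fc * x + (∑' n, R3Term x n - x ^ 3 * Real.log x / 6))
        / (x ^ 3 * Real.log x) := by
    rw [R3_eq]
    field_simp
    ring
  rw [heq, Real.norm_eq_abs, abs_div, abs_of_pos (mul_pos hx3 hlog),
    div_le_div_iff₀ (mul_pos hx3 hlog) hlog, ← mul_assoc]
  refine mul_le_mul_of_nonneg_right ?_ hlog.le
  refine (abs_add_le _ _).trans ?_
  have h3 := abs_add_three (Dc * x ^ 3) (Ec * x ^ 2) (Fc * x)
  linarith
end

section
/- For every integer k ≥ 1 and every t ∈ (−k, −k+1), one has R₃(t) + ((k−1)k(k+1)/6)·log|t| ≥ 0; consequently d̃₃(t) ≥ 0 for every real t. -/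
open Complex Filter Topology Set

open scoped ComplexOrder in
theorem re_deriv_riemannZeta_two_nonpos : (deriv riemannZeta 2).re ≤ 0 := by
  have h := ArithmeticFunction.LSeries_vonMangoldt_eq_deriv_riemannZeta_div
    (s := 2) (by norm_num)
  have hL : (0 : ℂ) ≤ LSeries (fun n ↦ (ArithmeticFunction.vonMangoldt n : ℂ)) ((2 : ℝ) : ℂ) :=
    tsum_nonneg fun n ↦ LSeries.term_nonneg
      (Complex.zero_le_real.2 ArithmeticFunction.vonMangoldt_nonneg) 2
  have hz : riemannZeta 2 = ((Real.pi ^ 2 / 6 : ℝ) : ℂ) := by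
    rw [riemannZeta_two]; push_cast; rfl
  have hpos : 0 < Real.pi ^ 2 / 6 := by positivity
  have hz0 : riemannZeta 2 ≠ 0 := by
    rw [hz]; exact_mod_cast hpos.ne'
  rw [eq_div_iff hz0, hz] at h
  have hre := congrArg Complex.re h
  rw [Complex.re_mul_ofReal, Complex.neg_re] at hre
  have hLre := mul_nonneg (Complex.le_def.1 hL).1 hpos.le
  rw [Complex.ofReal_ofNat] at hLre
  linarith

theorem deriv_riemannZeta_neg_one :
    deriv riemannZeta (-1) = 2 * (2 * Real.pi : ℂ) ^ (-2 : ℂ) *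
      ((1 - Real.eulerMascheroniConstant - Real.log (2 * Real.pi) : ℝ) * riemannZeta 2 +
        deriv riemannZeta 2) := by
  have hpi : (2 * Real.pi : ℂ) ≠ 0 := by simp [Real.pi_ne_zero]
  have hleft : HasDerivAt (fun s : ℂ ↦ riemannZeta (1 - s)) (deriv riemannZeta (-1) * (-1)) 2 := by
    have h1 : HasDerivAt riemannZeta (deriv riemannZeta (-1)) (1 - 2 : ℂ) := by
      have : (1 - 2 : ℂ) = -1 := by norm_num
      rw [this]
      exact (differentiableAt_riemannZeta (by norm_num)).hasDerivAt
    exact h1.comp 2 ((hasDerivAt_id (2 : ℂ)).const_sub 1)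
  have hpow : HasDerivAt (fun s : ℂ ↦ (2 * Real.pi : ℂ) ^ (-s))
      ((2 * Real.pi : ℂ) ^ (-2 : ℂ) * Complex.log (2 * Real.pi) * (-1)) 2 :=
    (hasDerivAt_id (2 : ℂ)).neg.const_cpow (Or.inl hpi)
  have hGamma : HasDerivAt Complex.Gamma (1 - Real.eulerMascheroniConstant : ℂ) 2 := by
    have := Complex.hasDerivAt_Gamma_nat 1
    norm_num at this
    convert this using 1
    ring
  have hcos : HasDerivAt (fun s : ℂ ↦ Complex.cos (Real.pi * s / 2)) 0 2 := by
    have h1 : HasDerivAt (fun s : ℂ ↦ (Real.pi * s / 2 : ℂ)) (Real.pi * 1 / 2) 2 :=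
      ((hasDerivAt_id (2 : ℂ)).const_mul (Real.pi : ℂ)).div_const 2
    have := h1.ccos
    simpa using this
  have hz : HasDerivAt riemannZeta (deriv riemannZeta 2) 2 :=
    (differentiableAt_riemannZeta (by norm_num)).hasDerivAt
  have hright := (((hpow.const_mul 2).mul hGamma).mul hcos).mul hz
  have heq : (fun s : ℂ ↦ riemannZeta (1 - s)) =ᶠ[𝓝 2]
      fun s ↦ 2 * (2 * Real.pi : ℂ) ^ (-s) * Complex.Gamma s *
        Complex.cos (Real.pi * s / 2) * riemannZeta s := by
    have hU : {s : ℂ | 1 < s.re} ∈ 𝓝 (2 : ℂ) :=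
      (isOpen_lt continuous_const Complex.continuous_re).mem_nhds (by norm_num)
    filter_upwards [hU] with s hs
    refine riemannZeta_one_sub (fun n hn ↦ ?_) (fun hn ↦ ?_)
    · rw [hn] at hs
      simp only [Complex.neg_re, Complex.natCast_re] at hs
      linarith [(Nat.cast_nonneg n : (0 : ℝ) ≤ n)]
    · rw [hn] at hs
      simp at hs
  have huniq := hleft.unique (hright.congr_of_eventuallyEq heq)
  have hlog : Complex.log (2 * Real.pi) = (Real.log (2 * Real.pi) : ℝ) := by
    rw [Complex.ofReal_log (by positivity)]; push_cast; rfl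
  have hG2 : Complex.Gamma 2 = 1 := by
    simp
  have hcos2 : Complex.cos (Real.pi * 2 / 2) = -1 := by simp
  simp only [Pi.mul_apply, hlog, hG2, hcos2] at huniq
  push_cast at huniq ⊢
  linear_combination -huniq

theorem three_halves_le_log_two_pi : 3 / 2 ≤ Real.log (2 * Real.pi) := by
  rw [Real.le_log_iff_exp_le (by positivity)]
  have h1 : Real.exp (3 / 2) ^ 2 = Real.exp 1 ^ 3 := by
    rw [← Real.exp_nat_mul, ← Real.exp_nat_mul]; norm_num
  have h2 : Real.exp 1 ^ 3 ≤ 3 ^ 3 := by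
    gcongr
    linarith [Real.exp_one_lt_d9]
  have h3 := Real.pi_gt_three
  nlinarith [Real.exp_pos (3 / 2 : ℝ)]

theorem re_deriv_riemannZeta_neg_one_nonpos : (deriv riemannZeta (-1)).re ≤ 0 := by
  have hpow : (2 * (2 * Real.pi : ℂ) ^ (-2 : ℂ)) = ((2 * (2 * Real.pi) ^ (-2 : ℝ) : ℝ) : ℂ) := by
    rw [Complex.ofReal_mul, Complex.ofReal_cpow (by positivity)]
    push_cast
    rfl
  have hz : riemannZeta 2 = ((Real.pi ^ 2 / 6 : ℝ) : ℂ) := by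
    rw [riemannZeta_two]; push_cast; rfl
  rw [deriv_riemannZeta_neg_one, hpow, Complex.re_ofReal_mul, hz, Complex.add_re,
    ← Complex.ofReal_mul, Complex.ofReal_re]
  refine mul_nonpos_of_nonneg_of_nonpos (by positivity) ?_
  have h1 : (1 - Real.eulerMascheroniConstant - Real.log (2 * Real.pi)) * (Real.pi ^ 2 / 6) ≤ 0 :=
    mul_nonpos_of_nonpos_of_nonneg
      (by linarith [three_halves_le_log_two_pi, Real.one_half_lt_eulerMascheroniConstant])
      (by positivity)
  linarith [re_deriv_riemannZeta_two_nonpos]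

theorem Fc_nonpos : Fc ≤ 0 := by
  unfold Fc
  linarith [three_halves_le_log_two_pi, re_deriv_riemannZeta_neg_one_nonpos]

noncomputable section

/-- The `i`-th term of the series for `R₃(-s)`, after absorbing the `π²/6` part of the cubic
coefficient into the series. -/
def absorbedTerm (s : ℝ) (i : ℕ) : ℝ :=
  -(((i : ℝ) + 1) * ((i : ℝ) + 2) / 2) * Real.log |1 - s / ((i : ℝ) + 1)|
    - ((i : ℝ) + 2) / 2 * s - 1 / 4 * (1 + 1 / ((i : ℝ) + 1)) * s ^ 2 - s ^ 3 / (6 * ((i : ℝ) + 1))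

/-- A function of `r` whose backward differences bound `absorbedTerm s` from below. -/
def tailBound (s r : ℝ) : ℝ :=
  s ^ 3 / 6 * (1 / r + 1 / (2 * r ^ 2)) + s ^ 4 / 8 * (1 / r + 1 / r ^ 2 + 1 / (2 * r ^ 3))
    + s ^ 5 / 10 * (1 / (2 * r ^ 2) + 5 / (6 * r ^ 3))

/-- The elementary lower bound for `R₃(-s) + N₃(s) log s` on `n < s < n + 1`, where `L` stands for
`log (n + 1)`. -/
def elementaryBound (n s L : ℝ) : ℝ :=
  (n * (n + 1) * (n + 2) / 6 - s ^ 3 / 6 - s ^ 2 / 4) * L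
    - ((n + 1) ^ 3 / 18 + (n + 1) ^ 2 / 8 - (n + 1) / 72 - 1 / 6)
    + s ^ 3 / 4 + s ^ 2 / 2 - n * (n + 3) / 4 * s - n / 4 * s ^ 2
    + n * (n + 2) * (3 * n + 1) / 24
    + n * (12 * n ^ 3 + 33 * n ^ 2 + 17 * n - 2) / (240 * (n + 1)) + tailBound s (n + 1)

end

theorem hasSum_one_div_add_one_sq :
    HasSum (fun n : ℕ ↦ 1 / ((n : ℝ) + 1) ^ 2) (Real.pi ^ 2 / 6) := by
  simpa using (hasSum_nat_add_iff' 1).2 hasSum_zeta_two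

theorem sum_pow_div_le_neg_log_one_sub {x : ℝ} (h0 : 0 ≤ x) (h1 : x < 1) (m : ℕ) :
    ∑ i ∈ Finset.range m, x ^ (i + 1) / ((i : ℝ) + 1) ≤ -Real.log (1 - x) :=
  sum_le_hasSum _ (fun i _ ↦ by positivity)
    (Real.hasSum_pow_div_log_of_abs_lt_one (by rwa [abs_of_nonneg h0]))

theorem summable_R3_term (s : ℝ) :
    Summable fun i : ℕ ↦ absorbedTerm s i - s ^ 3 / 6 * (1 / ((i : ℝ) + 1) ^ 2) := by
  have hmaj : Summable fun i : ℕ ↦ 2 * s ^ 4 * (1 / ((i : ℝ) + 1) ^ 2) :=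
    hasSum_one_div_add_one_sq.summable.mul_left _
  refine hmaj.of_norm_bounded_eventually_nat ?_
  filter_upwards [eventually_ge_atTop ⌈2 * |s|⌉₊] with i hi
  have hi' : 2 * |s| ≤ (i : ℝ) := (Nat.le_ceil _).trans (by exact_mod_cast hi)
  have hj : (0 : ℝ) < (i : ℝ) + 1 := by positivity
  set j : ℝ := (i : ℝ) + 1 with hjdef
  have habs : |s / j| ≤ 1 / 2 := by
    rw [abs_div, abs_of_pos hj, div_le_iff₀ hj]
    linarith
  have hlog := Real.abs_log_sub_add_sum_range_le (x := s / j) (by linarith) 3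
  simp only [Finset.sum_range_succ, Finset.sum_range_zero] at hlog
  norm_num at hlog
  have hpos : 0 < 1 - s / j := by linarith [le_abs_self (s / j)]
  have hfac : absorbedTerm s i - s ^ 3 / 6 * (1 / j ^ 2) = -(j * (j + 1) / 2) *
      (s / j + (s / j) ^ 2 / 2 + (s / j) ^ 3 / 3 + Real.log (1 - s / j)) := by
    have : (i : ℝ) + 2 = j + 1 := by rw [hjdef]; ring
    rw [absorbedTerm, this, ← hjdef, abs_of_pos hpos]
    field_simp
    ring
  have hbound : |s / j| ^ 4 / (1 - |s / j|) ≤ 2 * |s / j| ^ 4 := by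
    rw [div_le_iff₀ (by linarith)]
    nlinarith [pow_nonneg (abs_nonneg (s / j)) 4]
  have hj1 : 1 ≤ j := by rw [hjdef]; linarith [(Nat.cast_nonneg i : (0 : ℝ) ≤ i)]
  rw [hfac, norm_mul, Real.norm_eq_abs, Real.norm_eq_abs, abs_neg,
    abs_of_pos (by positivity : 0 < j * (j + 1) / 2)]
  have hx4 : |s / j| ^ 4 = s ^ 4 / j ^ 4 := by
    rw [← abs_pow, abs_of_nonneg (by positivity), div_pow]
  calc _ ≤ j ^ 2 * (2 * |s / j| ^ 4) := by
        exact mul_le_mul (by nlinarith) (hlog.trans hbound) (abs_nonneg _) (by positivity)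
    _ = _ := by rw [hx4]; field_simp

theorem summable_absorbedTerm (s : ℝ) : Summable (absorbedTerm s) := by
  refine ((summable_R3_term s).add
    (hasSum_one_div_add_one_sq.summable.mul_left (s ^ 3 / 6))).congr fun i ↦ ?_
  ring

theorem R3_neg_eq (s : ℝ) :
    R3 (-s) = (γ + 3 / 2) / 6 * s ^ 3 + Ec * s ^ 2 - Fc * s + ∑' i, absorbedTerm s i := by
  have h := (summable_R3_term s).tsum_add
    (hasSum_one_div_add_one_sq.summable.mul_left (s ^ 3 / 6))
  rw [tsum_mul_left, hasSum_one_div_add_one_sq.tsum_eq] at h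
  simp only [sub_add_cancel] at h
  rw [h, R3, Dc]
  have hterm : ∀ i : ℕ,
      (let k : ℝ := (i : ℝ) + 1;
        -(k * (k + 1) / 2) * Real.log |1 + -s / k| + ((k + 1) / 2) * -s
          - (1 / 4) * (1 + 1 / k) * (-s) ^ 2 + (1 / (6 * k)) * (1 + 1 / k) * (-s) ^ 3) =
        absorbedTerm s i - s ^ 3 / 6 * (1 / ((i : ℝ) + 1) ^ 2) := by
    intro i
    have hj : (i : ℝ) + 1 ≠ 0 := by positivity
    have : 1 + -s / ((i : ℝ) + 1) = 1 - s / ((i : ℝ) + 1) := by ring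
    simp only [absorbedTerm, this]
    field_simp
    ring
  rw [tsum_congr hterm]
  ring

theorem le_tsum_of_sub_le {f u : ℕ → ℝ} (hf : Summable f) (hu : Tendsto u atTop (𝓝 0))
    (h : ∀ i, u i - u (i + 1) ≤ f i) : u 0 ≤ ∑' i, f i := by
  have hlim : Tendsto (fun n ↦ u 0 - u n) atTop (𝓝 (u 0)) := by
    simpa using hu.const_sub (u 0)
  refine le_of_tendsto_of_tendsto' hlim hf.hasSum.tendsto_sum_nat fun n ↦ ?_
  rw [← Finset.sum_range_sub']
  exact Finset.sum_le_sum fun i _ ↦ h i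

theorem tendsto_tailBound (s : ℝ) (n : ℕ) :
    Tendsto (fun i : ℕ ↦ tailBound s ((i + n : ℕ) + 1)) atTop (𝓝 0) := by
  have h : Tendsto (fun i : ℕ ↦ 1 / (((i + n : ℕ) : ℝ) + 1)) atTop (𝓝 0) :=
    (tendsto_add_atTop_iff_nat n).2 (tendsto_one_div_add_atTop_nhds_zero_nat (𝕜 := ℝ))
  have h2 := h.pow 2
  have h3 := h.pow 3
  have := ((((h.add (h2.const_mul (1 / 2))).const_mul (s ^ 3 / 6)).add
    (((h.add h2).add (h3.const_mul (1 / 2))).const_mul (s ^ 4 / 8))).add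
    (((h2.const_mul (1 / 2)).add (h3.const_mul (5 / 6))).const_mul (s ^ 5 / 10)))
  norm_num at this
  refine this.congr fun i ↦ ?_
  unfold tailBound
  push_cast
  have : (i : ℝ) + n + 1 ≠ 0 := by positivity
  field_simp

theorem tailBound_sub_le {s : ℝ} {i : ℕ} (hs : 0 ≤ s) (hi : s < (i : ℝ) + 1) :
    tailBound s ((i : ℝ) + 1) - tailBound s ((i : ℝ) + 1 + 1) ≤ absorbedTerm s i := by
  have hj : (0 : ℝ) < (i : ℝ) + 1 := by positivity
  have h2 : (i : ℝ) + 2 = (i : ℝ) + 1 + 1 := by ring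
  rw [absorbedTerm, h2]
  generalize (i : ℝ) + 1 = j at hi hj
  have hx : s / j < 1 := (div_lt_one hj).2 hi
  have hlog := sum_pow_div_le_neg_log_one_sub (div_nonneg hs hj.le) hx 5
  simp only [Finset.sum_range_succ, Finset.sum_range_zero] at hlog
  norm_num at hlog
  rw [abs_of_pos (by linarith)]
  have hmul := mul_le_mul_of_nonneg_left hlog (by positivity : 0 ≤ j * (j + 1) / 2)
  have hd1 : 1 / j + 1 / (2 * j ^ 2) - (1 / (j + 1) + 1 / (2 * (j + 1) ^ 2)) ≤ 1 / j ^ 2 := by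
    rw [← sub_nonneg]
    have : 1 / j ^ 2 - (1 / j + 1 / (2 * j ^ 2) - (1 / (j + 1) + 1 / (2 * (j + 1) ^ 2))) =
        1 / (2 * j ^ 2 * (j + 1) ^ 2) := by field_simp; ring
    rw [this]; positivity
  have hd2 : 1 / (2 * j ^ 2) + 1 / (2 * j ^ 3) - (1 / (2 * (j + 1) ^ 2) + 1 / (2 * (j + 1) ^ 3)) ≤
      1 / j ^ 3 := by
    rw [← sub_nonneg]
    have : 1 / j ^ 3 -
        (1 / (2 * j ^ 2) + 1 / (2 * j ^ 3) - (1 / (2 * (j + 1) ^ 2) + 1 / (2 * (j + 1) ^ 3))) =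
        (2 * j + 1) / (2 * j ^ 3 * (j + 1) ^ 3) := by field_simp; ring
    rw [this]; positivity
  have hd3 : 1 / (3 * j ^ 3) - 1 / (3 * (j + 1) ^ 3) ≤ 1 / j ^ 4 := by
    rw [← sub_nonneg]
    have : 1 / j ^ 4 - (1 / (3 * j ^ 3) - 1 / (3 * (j + 1) ^ 3)) =
        (6 * j ^ 2 + 8 * j + 3) / (3 * j ^ 4 * (j + 1) ^ 3) := by field_simp; ring
    rw [this]; positivity
  have hs3 := mul_le_mul_of_nonneg_left hd1 (by positivity : 0 ≤ s ^ 3 / 6)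
  have hs4 := mul_le_mul_of_nonneg_left (add_le_add hd1 hd2) (by positivity : 0 ≤ s ^ 4 / 8)
  have hs5 := mul_le_mul_of_nonneg_left (add_le_add hd2 hd3) (by positivity : 0 ≤ s ^ 5 / 10)
  have hexp : j * (j + 1) / 2 * (s / j + (s / j) ^ 2 / 2 + (s / j) ^ 3 / 3 + (s / j) ^ 4 / 4 +
      (s / j) ^ 5 / 5) = (j + 1) / 2 * s + 1 / 4 * (1 + 1 / j) * s ^ 2 + s ^ 3 / (6 * j) +
        s ^ 3 / 6 * (1 / j ^ 2) + s ^ 4 / 8 * (1 / j ^ 2 + 1 / j ^ 3) +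
        s ^ 5 / 10 * (1 / j ^ 3 + 1 / j ^ 4) := by
    field_simp
    ring
  have hsplit : ∀ r : ℝ, 0 < r → tailBound s r = s ^ 3 / 6 * (1 / r + 1 / (2 * r ^ 2)) +
      s ^ 4 / 8 * (1 / r + 1 / (2 * r ^ 2) + (1 / (2 * r ^ 2) + 1 / (2 * r ^ 3))) +
      s ^ 5 / 10 * (1 / (2 * r ^ 2) + 1 / (2 * r ^ 3) + 1 / (3 * r ^ 3)) := by
    intro r hr
    unfold tailBound
    field_simp
    ring
  rw [hsplit j hj, hsplit (j + 1) (by positivity)]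
  linarith

theorem tailBound_le_tsum {s : ℝ} {n : ℕ} (hs : 0 ≤ s) (hn : s < (n : ℝ) + 1) :
    tailBound s ((n : ℝ) + 1) ≤ ∑' i, absorbedTerm s (i + n) := by
  have h := le_tsum_of_sub_le ((summable_nat_add_iff n).2 (summable_absorbedTerm s))
    (tendsto_tailBound s n) fun i ↦ by
      have hi : s < ((i + n : ℕ) : ℝ) + 1 := by
        push_cast
        linarith [(Nat.cast_nonneg i : (0 : ℝ) ≤ i)]
      have := tailBound_sub_le hs hi
      convert this using 3
      push_cast
      ring
  simpa using h

theorem log_le_half_sub_inv {x : ℝ} (hx : 1 ≤ x) : Real.log x ≤ (x - x⁻¹) / 2 := by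
  rw [← Real.sinh_log (by linarith)]
  exact Real.self_le_sinh_iff.2 (Real.log_nonneg hx)

theorem sum_triangular_mul_log_ge (n : ℕ) :
    (n : ℝ) * (n + 1) * (n + 2) / 6 * Real.log (n + 1)
      - (((n : ℝ) + 1) ^ 3 / 18 + ((n : ℝ) + 1) ^ 2 / 8 - ((n : ℝ) + 1) / 72 - 1 / 6) ≤
    ∑ i ∈ Finset.range n, ((i : ℝ) + 1) * (i + 2) / 2 * Real.log (i + 1) := by
  induction n with
  | zero => norm_num
  | succ n ih =>
    rw [Finset.sum_range_succ]
    push_cast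
    have hn : (0 : ℝ) < (n : ℝ) + 1 := by positivity
    have hlog := log_le_half_sub_inv (x := ((n : ℝ) + 1 + 1) / (n + 1))
      (by rw [le_div_iff₀ hn]; linarith)
    rw [Real.log_div (by positivity) (by positivity)] at hlog
    have hmul := mul_le_mul_of_nonneg_left hlog
      (by positivity : 0 ≤ ((n : ℝ) + 1) * (n + 2) * (n + 3) / 6)
    have hexp : ((n : ℝ) + 1) * (n + 2) * (n + 3) / 6 *
        ((((n : ℝ) + 1 + 1) / (n + 1) - (((n : ℝ) + 1 + 1) / (n + 1))⁻¹) / 2) =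
        (2 * n + 3) * (n + 3) / 12 := by
      field_simp
      ring
    rw [hexp] at hmul
    linarith

theorem sum_add_one_mul_add_two (n : ℕ) :
    ∑ i ∈ Finset.range n, ((i : ℝ) + 1) * (i + 2) = (n : ℝ) * (n + 1) * (n + 2) / 3 := by
  induction n with
  | zero => simp
  | succ n ih => rw [Finset.sum_range_succ, ih]; push_cast; ring

theorem sum_triangular_mul (n : ℕ) :
    ∑ i ∈ Finset.range n, ((i : ℝ) + 1) * (i + 2) / 2 * (i + 1) =
      (n : ℝ) * (n + 1) * (n + 2) * (3 * n + 1) / 24 := by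
  induction n with
  | zero => simp
  | succ n ih => rw [Finset.sum_range_succ, ih]; push_cast; ring

theorem sum_triangular_mul_sq (n : ℕ) :
    ∑ i ∈ Finset.range n, ((i : ℝ) + 1) * (i + 2) / 2 * (i + 1) ^ 2 =
      (n : ℝ) * (n + 1) * (12 * n ^ 3 + 33 * n ^ 2 + 17 * n - 2) / 120 := by
  induction n with
  | zero => simp
  | succ n ih => rw [Finset.sum_range_succ, ih]; push_cast; ring

theorem sum_range_natCast (n : ℕ) :
    ∑ i ∈ Finset.range n, (i : ℝ) = (n : ℝ) * (n - 1) / 2 := by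
  induction n with
  | zero => simp
  | succ n ih => rw [Finset.sum_range_succ, ih]; push_cast; ring

theorem sum_one_div_le (n : ℕ) :
    ∑ i ∈ Finset.range n, 1 / ((i : ℝ) + 1) ≤ γ + Real.log (n + 1) := by
  have h := Real.eulerMascheroniSeq_lt_eulerMascheroniConstant n
  rw [Real.eulerMascheroniSeq, harmonic] at h
  push_cast at h
  simp only [one_div, γ]
  linarith

theorem absorbedTerm_add_log_ge {s K : ℝ} {i : ℕ} (hi : (i : ℝ) + 1 < s) (hK : s ≤ K) :
    ((i : ℝ) + 1) * (i + 2) / 2 * Real.log (i + 1)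
      + ((i : ℝ) + 1) * (i + 2) / 2 * (i + 1) / K
      + ((i : ℝ) + 1) * (i + 2) / 2 * (i + 1) ^ 2 / (2 * K ^ 2)
      - ((i : ℝ) + 2) / 2 * s - s ^ 2 / 4 - s ^ 2 / 4 * (1 / ((i : ℝ) + 1))
      - s ^ 3 / 6 * (1 / ((i : ℝ) + 1)) ≤
    absorbedTerm s i + ((i : ℝ) + 1) * (i + 2) / 2 * Real.log s := by
  have hj : (0 : ℝ) < (i : ℝ) + 1 := by positivity
  have h2 : (i : ℝ) + 2 = (i : ℝ) + 1 + 1 := by ring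
  rw [absorbedTerm, h2]
  generalize (i : ℝ) + 1 = j at hi hj
  have hs : 0 < s := hj.trans hi
  have hKpos : 0 < K := hs.trans_le hK
  have hsj : s / j > 1 := (one_lt_div hj).2 hi
  have hx : j / s < 1 := (div_lt_one hs).2 hi
  have hlog := sum_pow_div_le_neg_log_one_sub (by positivity : 0 ≤ j / s) hx 2
  simp only [Finset.sum_range_succ, Finset.sum_range_zero] at hlog
  norm_num at hlog
  have habs : Real.log |1 - s / j| = Real.log s - Real.log j + Real.log (1 - j / s) := by
    rw [abs_of_neg (by linarith), ← Real.log_div hs.ne' hj.ne',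
      ← Real.log_mul (by positivity) (by linarith)]
    congr 1
    field_simp
    ring
  have hle : j / K ≤ j / s := by gcongr
  have hle2 : (j / K) ^ 2 ≤ (j / s) ^ 2 := by gcongr
  have hmul := mul_le_mul_of_nonneg_left
    (by linarith : j / K + (j / K) ^ 2 / 2 ≤ -Real.log (1 - j / s))
    (by positivity : 0 ≤ j * (j + 1) / 2)
  rw [habs]
  have hexp : j * (j + 1) / 2 * (j / K + (j / K) ^ 2 / 2) =
      j * (j + 1) / 2 * j / K + j * (j + 1) / 2 * j ^ 2 / (2 * K ^ 2) := by
    field_simp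
  have hcub : s ^ 3 / (6 * j) = s ^ 3 / 6 * (1 / j) := by field_simp
  rw [hexp] at hmul
  rw [hcub]
  linarith

theorem elementaryBound_affine (n s L : ℝ) :
    elementaryBound n s L = (n * (n + 1) * (n + 2) / 6 - s ^ 3 / 6 - s ^ 2 / 4) * L
      + elementaryBound n s 0 := by
  unfold elementaryBound
  ring

theorem elementaryBound_low_nonneg {m x y : ℝ} (hm : 0 ≤ m) (hx : 0 ≤ x) (hy : 0 ≤ y)
    (hxy : x + y = 1) : 0 ≤ elementaryBound (1 + m) (1 + m + x) (69 / 100) := by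
  have h : elementaryBound (1 + m) (1 + m + x) (69 / 100) =
      ((177 * y ^ 5 + 12213 * x * y ^ 4 + 94128 * x ^ 2 * y ^ 3 +
          236064 * x ^ 3 * y ^ 2 + 243936 * x ^ 4 * y + 90624 * x ^ 5) +
        m * (5818 * y ^ 5 + 71774 * x * y ^ 4 + 341524 * x ^ 2 * y ^ 3 +
          696340 * x ^ 3 * y ^ 2 + 632564 * x ^ 4 * y + 211972 * x ^ 5) +
        m ^ 2 * (15822 * y ^ 5 + 140058 * x * y ^ 4 + 501480 * x ^ 2 * y ^ 3 +
          846828 * x ^ 3 * y ^ 2 + 671688 * x ^ 4 * y + 202104 * x ^ 5) +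
        m ^ 3 * (16946 * y ^ 5 + 125686 * x * y ^ 4 + 371069 * x ^ 2 * y ^ 3 +
          532637 * x ^ 3 * y ^ 2 + 370081 * x ^ 4 * y + 99773 * x ^ 5) +
        m ^ 4 * (8621 * y ^ 5 + 55927 * x * y ^ 4 + 142556 * x ^ 2 * y ^ 3 +
          178316 * x ^ 3 * y ^ 2 + 109567 * x ^ 4 * y + 26501 * x ^ 5) +
        m ^ 5 * (2016 * y ^ 5 + 11538 * x * y ^ 4 + 25992 * x ^ 2 * y ^ 3 +
          28908 * x ^ 3 * y ^ 2 + 15912 * x ^ 4 * y + 3474 * x ^ 5) +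
        m ^ 6 * (160 * y ^ 5 + 800 * x * y ^ 4 + 1600 * x ^ 2 * y ^ 3 +
          1600 * x ^ 3 * y ^ 2 + 800 * x ^ 4 * y + 160 * x ^ 5))
        / (3600 * (m + 2) ^ 3) := by
    obtain rfl : y = 1 - x := by linarith
    have h2 : 1 + m + 1 ≠ 0 := by positivity
    have h3 : m + 2 ≠ 0 := by positivity
    unfold elementaryBound tailBound
    field_simp
    ring
  rw [h]
  positivity

theorem elementaryBound_high_nonneg {m x y : ℝ} (hm : 0 ≤ m) (hx : 0 ≤ x) (hy : 0 ≤ y)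
    (hxy : x + y = 1) : 0 ≤ elementaryBound (1 + m) (1 + m + x) (1 + (m + 2) / 7) := by
  have h : elementaryBound (1 + m) (1 + m + x) (1 + (m + 2) / 7) =
      ((14259 * y ^ 5 + 63135 * x * y ^ 4 + 157800 * x ^ 2 * y ^ 3 +
          268440 * x ^ 3 * y ^ 2 + 253440 * x ^ 4 * y + 94848 * x ^ 5) +
        m * (52538 * y ^ 5 + 244630 * x * y ^ 4 + 567440 * x ^ 2 * y ^ 3 +
          814880 * x ^ 3 * y ^ 2 + 652300 * x ^ 4 * y + 213020 * x ^ 5) +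
        m ^ 2 * (78528 * y ^ 5 + 376620 * x * y ^ 4 + 819570 * x ^ 2 * y ^ 3 +
          1014150 * x ^ 3 * y ^ 2 + 685320 * x ^ 4 * y + 192648 * x ^ 5) +
        m ^ 3 * (60655 * y ^ 5 + 292415 * x * y ^ 4 + 597190 * x ^ 2 * y ^ 3 +
          648130 * x ^ 3 * y ^ 2 + 371075 * x ^ 4 * y + 88375 * x ^ 5) +
        m ^ 4 * (25255 * y ^ 5 + 119195 * x * y ^ 4 + 227110 * x ^ 2 * y ^ 3 +
          218590 * x ^ 3 * y ^ 2 + 106355 * x ^ 4 * y + 20935 * x ^ 5) +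
        m ^ 5 * (5253 * y ^ 5 + 23565 * x * y ^ 4 + 41370 * x ^ 2 * y ^ 3 +
          35250 * x ^ 3 * y ^ 2 + 14385 * x ^ 4 * y + 2193 * x ^ 5) +
        m ^ 6 * (404 * y ^ 5 + 1660 * x * y ^ 4 + 2600 * x ^ 2 * y ^ 3 +
          1880 * x ^ 3 * y ^ 2 + 580 * x ^ 4 * y + 44 * x ^ 5))
        / (5040 * (m + 2) ^ 3) := by
    obtain rfl : y = 1 - x := by linarith
    have h2 : 1 + m + 1 ≠ 0 := by positivity
    have h3 : m + 2 ≠ 0 := by positivity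
    unfold elementaryBound tailBound
    field_simp
    ring
  rw [h]
  positivity

theorem log_le_one_add_div_seven {x : ℝ} (hx : 0 < x) : Real.log x ≤ 1 + x / 7 := by
  have he : 7 ≤ Real.exp 2 := by
    have h1 : Real.exp 2 = Real.exp 1 ^ 2 := by rw [← Real.exp_nat_mul]; norm_num
    nlinarith [Real.exp_one_gt_d9]
  have h := Real.log_le_sub_one_of_pos (div_pos hx (Real.exp_pos 2))
  rw [Real.log_div hx.ne' (Real.exp_pos 2).ne', Real.log_exp] at h
  have : x / Real.exp 2 ≤ x / 7 := by gcongr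
  linarith

theorem elementaryBound_log_nonneg {n s : ℝ} (hn : 1 ≤ n) (h1 : n ≤ s) (h2 : s ≤ n + 1) :
    0 ≤ elementaryBound n s (Real.log (n + 1)) := by
  have hlow := elementaryBound_low_nonneg (m := n - 1) (x := s - n) (y := n + 1 - s)
    (by linarith) (by linarith) (by linarith) (by ring)
  have hhigh := elementaryBound_high_nonneg (m := n - 1) (x := s - n) (y := n + 1 - s)
    (by linarith) (by linarith) (by linarith) (by ring)
  have e1 : 1 + (n - 1) = n := by ring
  have e2 : n + (s - n) = s := by ring
  have e3 : n - 1 + 2 = n + 1 := by ring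
  rw [e1, e2] at hlow hhigh
  rw [e3] at hhigh
  have hL1 : 69 / 100 ≤ Real.log (n + 1) := by
    have := Real.log_le_log (by norm_num : (0 : ℝ) < 2) (by linarith : 2 ≤ n + 1)
    linarith [Real.log_two_gt_d9]
  have hL2 := log_le_one_add_div_seven (by linarith : 0 < n + 1)
  rw [elementaryBound_affine] at hlow hhigh ⊢
  rcases le_total 0 (n * (n + 1) * (n + 2) / 6 - s ^ 3 / 6 - s ^ 2 / 4) with h | h
  · linarith [mul_le_mul_of_nonneg_left hL1 h]
  · linarith [mul_le_mul_of_nonpos_left hL2 h]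

theorem R3_neg_add_log_ge {n : ℕ} {s : ℝ} (h1 : (n : ℝ) < s) (h2 : s < (n : ℝ) + 1) :
    elementaryBound n s (Real.log (n + 1)) ≤
      R3 (-s) + (n : ℝ) * (n + 1) * (n + 2) / 6 * Real.log s := by
  have hs : 0 < s := (Nat.cast_nonneg n).trans_lt h1
  have hK : (n : ℝ) + 1 ≠ 0 := by positivity
  have htail := tailBound_le_tsum hs.le h2
  have hsplit := (summable_absorbedTerm s).sum_add_tsum_nat_add n
  have hfin := Finset.sum_le_sum fun i (hi : i ∈ Finset.range n) ↦
    absorbedTerm_add_log_ge (s := s) (K := (n : ℝ) + 1) (i := i)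
      (lt_of_le_of_lt (by exact_mod_cast Finset.mem_range.1 hi) h1) h2.le
  simp only [Finset.sum_add_distrib, Finset.sum_sub_distrib, ← Finset.sum_mul, ← Finset.mul_sum,
    ← Finset.sum_div, sum_add_one_mul_add_two, sum_triangular_mul, sum_triangular_mul_sq,
    sum_range_natCast, Finset.sum_const, Finset.card_range, nsmul_eq_mul] at hfin
  have hlogs := sum_triangular_mul_log_ge n
  have hharm := mul_le_mul_of_nonneg_left (sum_one_div_le n)
    (by positivity : 0 ≤ s ^ 3 / 6 + s ^ 2 / 4)
  have hE := mul_le_mul_of_nonneg_right three_halves_le_log_two_pi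
    (by positivity : 0 ≤ s ^ 2 / 4)
  have hF := mul_nonneg (neg_nonneg.2 Fc_nonpos) hs.le
  have e1 : (n : ℝ) * (n + 1) * (n + 2) * (3 * n + 1) / 24 / (n + 1) =
      (n : ℝ) * (n + 2) * (3 * n + 1) / 24 := by field_simp
  have e2 : (n : ℝ) * (n + 1) * (12 * n ^ 3 + 33 * n ^ 2 + 17 * n - 2) / 120 /
      (2 * ((n : ℝ) + 1) ^ 2) =
      (n : ℝ) * (12 * n ^ 3 + 33 * n ^ 2 + 17 * n - 2) / (240 * (n + 1)) := by
    field_simp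
    ring
  rw [e1, e2] at hfin
  rw [R3_neg_eq, ← hsplit, elementaryBound, Ec]
  linarith

theorem R3_neg_nonneg_of_lt_one {s : ℝ} (h0 : 0 < s) (h1 : s < 1) : 0 ≤ R3 (-s) := by
  have htail := tailBound_le_tsum (n := 0) h0.le (by simpa using h1)
  have hpos : 0 ≤ tailBound s (((0 : ℕ) : ℝ) + 1) := by
    unfold tailBound
    positivity
  have hγ : 0 < γ := (by norm_num : (0 : ℝ) < 1 / 2).trans Real.one_half_lt_eulerMascheroniConstant
  have hE : 0 ≤ Ec := by
    unfold Ec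
    linarith [three_halves_le_log_two_pi]
  have hF := mul_nonneg (neg_nonneg.2 Fc_nonpos) h0.le
  rw [R3_neg_eq]
  simp only [add_zero] at htail
  have h3 : 0 ≤ (γ + 3 / 2) / 6 * s ^ 3 := by positivity
  have h4 : 0 ≤ Ec * s ^ 2 := by positivity
  linarith

theorem R3_neg_add_log_nonneg {n : ℕ} {s : ℝ} (h1 : (n : ℝ) < s) (h2 : s < (n : ℝ) + 1) :
    0 ≤ R3 (-s) + (n : ℝ) * (n + 1) * (n + 2) / 6 * Real.log s := by
  rcases Nat.eq_zero_or_pos n with rfl | hn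
  · simpa using R3_neg_nonneg_of_lt_one (by simpa using h1) (by simpa using h2)
  · exact (elementaryBound_log_nonneg (by exact_mod_cast hn) h1.le h2.le).trans
      (R3_neg_add_log_ge h1 h2)

/-- `R₃(t) + ((k−1)k(k+1)/6) log|t| ≥ 0` on `(−k,−k+1)`, and consequently `d̃₃ ≥ 0`. -/
theorem d3tilde_nonneg :
    (∀ k : ℕ, 1 ≤ k → ∀ t ∈ Set.Ioo (-(k:ℝ)) (-(k:ℝ)+1),
        0 ≤ R3 t + (((k:ℝ)-1)*(k:ℝ)*((k:ℝ)+1)/6) * Real.log |t|) ∧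
      ∀ t : ℝ, 0 ≤ d3tilde t := by
  refine ⟨fun k hk t ht ↦ ?_, fun t ↦ ?_⟩
  · obtain ⟨n, rfl⟩ := Nat.exists_eq_add_of_le' hk
    obtain ⟨ht1, ht2⟩ := ht
    push_cast at ht1 ht2 ⊢
    have h := R3_neg_add_log_nonneg (n := n) (s := -t) (by linarith) (by linarith)
    rw [neg_neg, Real.log_neg_eq_log] at h
    rw [Real.log_abs]
    convert h using 3
    ring
  · unfold d3tilde
    split_ifs with ht
    · obtain ⟨ht0, hint⟩ := ht
      have hs : 0 < -t := by linarith
      have hn1 : (⌊-t⌋₊ : ℝ) ≤ -t := Nat.floor_le hs.le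
      have hn2 : -t < (⌊-t⌋₊ : ℝ) + 1 := Nat.lt_floor_add_one _
      have hne : (⌊-t⌋₊ : ℝ) ≠ -t := by
        intro heq
        rcases hc : ⌊-t⌋₊ with _ | n
        · rw [hc] at heq
          simp at heq
          linarith
        · rw [hc] at heq
          push_cast at heq
          exact hint ⟨n, by linarith⟩
      have h := R3_neg_add_log_nonneg (lt_of_le_of_ne hn1 hne) hn2
      have hfloor : ((⌊-t⌋ : ℤ) : ℝ) = (⌊-t⌋₊ : ℝ) := (natCast_floor_eq_intCast_floor hs.le).symm
      rw [neg_neg, Real.log_neg_eq_log] at h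
      rw [abs_of_neg ht0, N3, hfloor, Real.log_neg_eq_log]
      refine div_nonneg_of_nonpos (neg_nonpos.2 h) (mul_nonpos_of_nonpos_of_nonneg ?_ ?_)
      · exact (Odd.pow_neg (by decide) ht0).le
      · positivity
    · exact le_rfl
end

section
/- Let k ≥ 1 be an integer and t ∈ (−k, −k+1). Let g be a holomorphic function on the open upper half-plane H = {z : Im z > 0} such that exp(g(z)) = Γ(z) for all z ∈ H (Γ the complex Gamma function), and such that for every x > 0, g(z) → log Γ(x) (real logarithm of the positive number Γ(x)) as z → x within H. Then, as z → t within H, g(z) → log|Γ(t)| − iπk. -/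
open Complex Filter Topology Set

/-- A holomorphic function on the upper half-plane with `exp ∘ h = 1` is constant. -/
theorem eq_of_exp_eq_one_on_upperHalfPlane {h : ℂ → ℂ}
    (hd : DifferentiableOn ℂ h {z : ℂ | 0 < z.im})
    (he : ∀ z : ℂ, 0 < z.im → Complex.exp (h z) = 1) {z w : ℂ} (hz : 0 < z.im) (hw : 0 < w.im) :
    h z = h w := by
  have ho : IsOpen {z : ℂ | 0 < z.im} := isOpen_lt continuous_const Complex.continuous_im
  refine ho.is_const_of_deriv_eq_zero (convex_halfSpace_im_gt 0).isPreconnected hd ?_ hz hw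
  intro u hu
  have h1 := ((hd.differentiableAt (ho.mem_nhds hu)).hasDerivAt).cexp
  have h2 : (fun v => Complex.exp (h v)) =ᶠ[𝓝 u] fun _ => (1 : ℂ) := by
    filter_upwards [ho.mem_nhds hu] with v hv using he v hv
  have h3 := h1.unique ((hasDerivAt_const u (1 : ℂ)).congr_of_eventuallyEq h2)
  simpa [Complex.exp_ne_zero] using h3

/-- Translation by `1` preserves approach to the real axis from the upper half-plane. -/
theorem tendsto_add_one_nhdsWithin_upperHalfPlane (x : ℝ) :
    Tendsto (fun z : ℂ => z + 1) (𝓝[{z : ℂ | 0 < z.im}] (x : ℂ))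
      (𝓝[{z : ℂ | 0 < z.im}] ((x + 1 : ℝ) : ℂ)) := by
  refine tendsto_nhdsWithin_iff.2 ⟨?_, ?_⟩
  · have : Continuous fun z : ℂ => z + 1 := by fun_prop
    simpa using (this.tendsto (x : ℂ)).mono_left nhdsWithin_le_nhds
  · filter_upwards [self_mem_nhdsWithin] with z hz
    simpa using hz

/-- The branch of `log Γ` that is real on the positive axis satisfies
`log Γ (z + 1) = log Γ z + log z`. -/
theorem log_Gamma_branch_add_one {g : ℂ → ℂ} (hd : DifferentiableOn ℂ g {z : ℂ | 0 < z.im})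
    (he : ∀ z : ℂ, 0 < z.im → Complex.exp (g z) = Complex.Gamma z)
    (hlim : ∀ x : ℝ, 0 < x →
      Tendsto g (𝓝[{z : ℂ | 0 < z.im}] (x : ℂ)) (𝓝 ((Real.log (Real.Gamma x) : ℂ))))
    {z : ℂ} (hz : 0 < z.im) : g (z + 1) = g z + Complex.log z := by
  have hne : ∀ u : ℂ, 0 < u.im → u ≠ 0 := by
    rintro u hu rfl
    simp at hu
  have hdiff : DifferentiableOn ℂ (fun u => g (u + 1) - g u - Complex.log u)
      {z : ℂ | 0 < z.im} := by
    refine ((hd.comp (by fun_prop) fun u hu => by simpa using hu).sub hd).sub ?_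
    exact differentiableOn_id.clog fun u hu => Or.inr (ne_of_gt hu)
  have hexp : ∀ u : ℂ, 0 < u.im → Complex.exp (g (u + 1) - g u - Complex.log u) = 1 := by
    intro u hu
    have hG : Complex.Gamma u ≠ 0 := he u hu ▸ Complex.exp_ne_zero _
    rw [Complex.exp_sub, Complex.exp_sub, he u hu, he (u + 1) (by simpa using hu),
      Complex.exp_log (hne u hu), Complex.Gamma_add_one u (hne u hu)]
    have := hne u hu
    field_simp
  have hlim1 : Tendsto (fun u => g (u + 1) - g u - Complex.log u)
      (𝓝[{z : ℂ | 0 < z.im}] ((1 : ℝ) : ℂ)) (𝓝 0) := by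
    have hlog : Tendsto Complex.log (𝓝[{z : ℂ | 0 < z.im}] ((1 : ℝ) : ℂ)) (𝓝 0) := by
      have := (continuousAt_clog (x := ((1 : ℝ) : ℂ)) (by simp)).tendsto
      simpa using this.mono_left nhdsWithin_le_nhds
    have h2 := (hlim (1 + 1) (by norm_num)).comp (tendsto_add_one_nhdsWithin_upperHalfPlane 1)
    have hG : Real.Gamma (1 + 1) = 1 := by rw [Real.Gamma_add_one one_ne_zero]; simp
    have h := (h2.sub (hlim 1 one_pos)).sub hlog
    rw [hG] at h
    simpa [Function.comp_def] using h
  have hbot : (𝓝[{z : ℂ | 0 < z.im}] ((1 : ℝ) : ℂ)).NeBot := by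
    rw [← mem_closure_iff_nhdsWithin_neBot, Complex.closure_setOfPred_lt_im]
    simp
  have hconst : Tendsto (fun u => g (u + 1) - g u - Complex.log u)
      (𝓝[{z : ℂ | 0 < z.im}] ((1 : ℝ) : ℂ)) (𝓝 (g (z + 1) - g z - Complex.log z)) := by
    refine tendsto_const_nhds.congr' ?_
    filter_upwards [self_mem_nhdsWithin] with u hu
    exact eq_of_exp_eq_one_on_upperHalfPlane hdiff hexp hz hu
  linear_combination tendsto_nhds_unique hconst hlim1

/-- Boundary values of a branch of `log Γ` on the upper half-plane at `t ∈ (−k,−k+1)`. -/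
theorem log_Gamma_boundary_limit :
    ∀ k : ℕ, 1 ≤ k → ∀ t : ℝ, t ∈ Set.Ioo (-(k:ℝ)) (-(k:ℝ)+1) →
      ∀ g : ℂ → ℂ, DifferentiableOn ℂ g {z : ℂ | 0 < z.im} →
        (∀ z : ℂ, 0 < z.im → Complex.exp (g z) = Complex.Gamma z) →
        (∀ x : ℝ, 0 < x →
          Tendsto g (𝓝[{z : ℂ | 0 < z.im}] (x : ℂ)) (𝓝 ((Real.log (Real.Gamma x) : ℂ)))) →
        Tendsto g (𝓝[{z : ℂ | 0 < z.im}] (t : ℂ))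
          (𝓝 ((Real.log |Real.Gamma t| : ℂ) - Real.pi * (k : ℂ) * Complex.I)) := by
  intro k _ t ht g hd he hlim
  clear * - ht hd he hlim
  induction k generalizing t with
  | zero =>
    have ht0 : 0 < t := by simpa using ht.1
    simpa [abs_of_pos (Real.Gamma_pos_of_pos ht0)] using hlim t ht0
  | succ k ih =>
    obtain ⟨ht1, ht2⟩ := ht
    push_cast at ht1 ht2
    have hk : (0 : ℝ) ≤ k := k.cast_nonneg
    have ht0 : t < 0 := by linarith
    have hshift := (ih (t + 1) ⟨by linarith, by linarith⟩).comp
      (tendsto_add_one_nhdsWithin_upperHalfPlane t)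
    have hlog := (Complex.tendsto_log_nhdsWithin_im_nonneg_of_re_neg_of_im_zero
      (z := (t : ℂ)) (by simpa using ht0) (by simp)).mono_left
      (nhdsWithin_mono (t : ℂ) fun z (hz : 0 < z.im) => show 0 ≤ z.im from hz.le)
    have hG : Real.Gamma t ≠ 0 := by
      refine Real.Gamma_ne_zero fun m hm => ?_
      have h1 : (m : ℝ) < k + 1 := by linarith
      have h2 : (k : ℝ) < m := by linarith
      norm_cast at h1 h2
      omega
    have hval : Real.log |Real.Gamma (t + 1)| = Real.log |t| + Real.log |Real.Gamma t| := by
      rw [Real.Gamma_add_one ht0.ne, abs_mul,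
        Real.log_mul (abs_ne_zero.2 ht0.ne) (abs_ne_zero.2 hG)]
    have hsub := hshift.sub hlog
    rw [hval, Complex.norm_real, Real.norm_eq_abs] at hsub
    refine Tendsto.congr' ?_ (hsub.trans_eq ?_)
    · filter_upwards [self_mem_nhdsWithin] with z hz
      simp [log_Gamma_branch_add_one hd he hlim hz]
    · congr 1
      push_cast
      ring
end
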